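/- arXiv:0811.3750 — 2 statements merged into one kernel-verified Lean document; each statement's English description precedes it below -/
import Mathlib

section
/- Let α, β be positive reals with α ≠ β, let a ∈ ℝ^d, and let M be a σ-finite Borel measure on ℝ^d with M({0}) = 0 and M({x : ‖x‖ > 1}) < ∞. Put a^{(β)} := (β/(β+1))(a + b_{M,β}) and a^{(α,β)} := (α/(α+1))(a^{(β)} + b_{M^{(β)},α}). Then a^{(α,β)} = (αβ/((1+α)(1+β))) a + (αβ/(β−α)) [ (1/(α+1)) b_{M,α} − (1/(β+1)) b_{M,β} ], which moreover equals (β/(β−α)) a^{(α)} − (α/(β−α)) a^{(β)}, where a^{(α)} := (α/(α+1))(a + b_{M,α}). (Proposition 3(i): the shift vector of 𝒥^α(𝒥^β(μ)) for μ = [a,R,M].) -/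
open MeasureTheory

/-- The measure `M^{(β)}`, the Lévy measure of `𝒥^β(μ)` when `μ` has Lévy
measure `M`: `M^{(β)}(A) = ∫₀¹ ∫ 1_A(t^{1/β} x) M(dx) dt`. -/
noncomputable def levyMeasureJ {d : ℕ} (M : Measure (EuclideanSpace ℝ (Fin d)))
    (β : ℝ) : Measure (EuclideanSpace ℝ (Fin d)) :=
  (volume.restrict (Set.Ioc (0:ℝ) 1)).bind fun t =>
    M.map fun x => (t ^ (1/β)) • x

lemma levyMeasureJ_eq_map_prod {d : ℕ} (M : Measure (EuclideanSpace ℝ (Fin d))) [SFinite M]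
    (β : ℝ) :
    levyMeasureJ M β = ((volume.restrict (Set.Ioc (0:ℝ) 1)).prod M).map
      fun p => (p.1 ^ (1/β)) • p.2 := by
  have hg : Measurable fun p : ℝ × EuclideanSpace ℝ (Fin d) => (p.1 ^ (1/β)) • p.2 := by
    fun_prop
  have hgt : ∀ t : ℝ, Measurable fun x : EuclideanSpace ℝ (Fin d) => (t ^ (1/β)) • x :=
    fun t => by fun_prop
  have hK : Measurable fun t : ℝ => M.map fun x => (t ^ (1/β)) • x := by
    refine Measure.measurable_of_measurable_coe _ fun s hs => ?_
    simp_rw [fun t => Measure.map_apply (μ := M) (hgt t) hs]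
    exact measurable_measure_prodMk_left (ν := M) (hg hs)
  ext s hs
  rw [levyMeasureJ, Measure.bind_apply hs hK.aemeasurable, Measure.map_apply hg hs,
    Measure.prod_apply (hg hs)]
  exact lintegral_congr fun t => Measure.map_apply (hgt t) hs

lemma norm_rpow_smul_le_one {E : Type*} [NormedAddCommGroup E] [NormedSpace ℝ E] {γ : ℝ}
    (hγ : 0 ≤ γ) {x : E} (hx : 1 < ‖x‖) : ‖(‖x‖ ^ (-1 - γ)) • x‖ ≤ 1 := by
  have h0 : 0 < ‖x‖ := by linarith
  rw [norm_smul, Real.norm_of_nonneg (by positivity)]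
  calc ‖x‖ ^ (-1 - γ) * ‖x‖ = ‖x‖ ^ (-γ) := by
        nth_rewrite 2 [← Real.rpow_one ‖x‖]
        rw [← Real.rpow_add h0]
        ring_nf
    _ ≤ 1 := Real.rpow_le_one_of_one_le_of_nonpos hx.le (by linarith)

lemma integrableOn_norm_rpow_smul {E : Type*} [NormedAddCommGroup E] [NormedSpace ℝ E]
    [MeasurableSpace E] [BorelSpace E] [SecondCountableTopology E] {M : Measure E} {γ : ℝ}
    (hγ : 0 ≤ γ) (hfin : M {x | 1 < ‖x‖} < ⊤) :
    IntegrableOn (fun x : E => (‖x‖ ^ (-1 - γ)) • x) {x | 1 < ‖x‖} M := by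
  refine IntegrableOn.of_bound hfin ?_ 1 ?_
  · exact Measurable.aestronglyMeasurable (by fun_prop)
  · exact ae_restrict_of_forall_mem (measurableSet_lt measurable_const measurable_norm)
      fun x hx => norm_rpow_smul_le_one hγ hx

lemma integral_Ioc_norm_rpow_smul {E : Type*} [NormedAddCommGroup E] [NormedSpace ℝ E]
    [CompleteSpace E] {α β : ℝ} (hβ : 0 < β) (hαβ : α ≠ β) (x : E) :
    ∫ t in Set.Ioc (0:ℝ) 1, {y : E | 1 < ‖y‖}.indicator
        (fun y => (‖y‖ ^ (-1 - α)) • y) ((t ^ (1/β)) • x)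
      = {y : E | 1 < ‖y‖}.indicator
        (fun y => (β / (β - α)) • ((‖y‖ ^ (-1 - α)) • y - (‖y‖ ^ (-1 - β)) • y)) x := by
  have hnorm : ∀ t : ℝ, 0 < t → ‖(t ^ (1/β)) • x‖ = t ^ (1/β) * ‖x‖ := fun t ht => by
    rw [norm_smul, Real.norm_of_nonneg (by positivity)]
  by_cases hx : 1 < ‖x‖
  · have h0 : 0 < ‖x‖ := by linarith
    have hc0 : 0 < ‖x‖ ^ (-β) := by positivity
    have hc1 : ‖x‖ ^ (-β) ≤ 1 := Real.rpow_le_one_of_one_le_of_nonpos hx.le (by linarith)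
    have hiff : ∀ t : ℝ, 0 < t → (1 < ‖(t ^ (1/β)) • x‖ ↔ ‖x‖ ^ (-β) < t) := fun t ht => by
      rw [hnorm t ht, ← Real.rpow_lt_rpow_iff (z := β) zero_le_one (by positivity) hβ,
        Real.one_rpow, Real.mul_rpow (by positivity) h0.le, ← Real.rpow_mul ht.le,
        one_div_mul_cancel hβ.ne', Real.rpow_one, Real.rpow_neg h0.le,
        inv_lt_iff_one_lt_mul₀ (by positivity)]
    have hset : ∫ t in Set.Ioc (0:ℝ) 1, {y : E | 1 < ‖y‖}.indicator
          (fun y => (‖y‖ ^ (-1 - α)) • y) ((t ^ (1/β)) • x)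
        = ∫ t in Set.Ioc (0:ℝ) 1, (Set.Ioc (‖x‖ ^ (-β)) 1).indicator
          (fun t : ℝ => (t ^ (-α/β)) • ((‖x‖ ^ (-1 - α)) • x)) t := by
      refine setIntegral_congr_fun measurableSet_Ioc fun t ht => ?_
      by_cases hct : ‖x‖ ^ (-β) < t
      · rw [Set.indicator_of_mem (show (t ^ (1/β)) • x ∈ {y : E | 1 < ‖y‖} from
            (hiff t ht.1).2 hct), Set.indicator_of_mem (Set.mem_Ioc.2 ⟨hct, ht.2⟩), hnorm t ht.1,
          Real.mul_rpow (Real.rpow_nonneg ht.1.le _) h0.le, smul_smul, smul_smul,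
          ← Real.rpow_mul ht.1.le, mul_right_comm, ← Real.rpow_add ht.1]
        congr 3
        field_simp
        ring
      · rw [Set.indicator_of_notMem (show (t ^ (1/β)) • x ∉ {y : E | 1 < ‖y‖} from
            fun h => hct ((hiff t ht.1).1 h)), Set.indicator_of_notMem fun h => hct h.1]
    have hne : -α/β ≠ -1 := by
      rw [ne_eq, div_eq_iff hβ.ne']
      intro h
      exact hαβ (by linarith)
    have hβα : β - α ≠ 0 := sub_ne_zero.2 hαβ.symm
    rw [hset, setIntegral_indicator measurableSet_Ioc,
      Set.inter_eq_self_of_subset_right (Set.Ioc_subset_Ioc_left hc0.le), integral_smul_const,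
      ← intervalIntegral.integral_of_le hc1,
      integral_rpow (Or.inr ⟨hne, by rw [Set.uIcc_of_le hc1]; exact fun h => hc0.not_ge h.1⟩),
      Set.indicator_of_mem (show x ∈ {y : E | 1 < ‖y‖} from hx), ← sub_smul, smul_smul, smul_smul,
      Real.one_rpow, ← Real.rpow_mul h0.le]
    have hexp : ‖x‖ ^ (-1 - β) = ‖x‖ ^ (-β * (-α/β + 1)) * ‖x‖ ^ (-1 - α) := by
      rw [← Real.rpow_add h0]
      congr 1
      field_simp
      ring
    have hden : -α/β + 1 = (β - α) / β := by
      field_simp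
      ring
    rw [hexp]
    congr 1
    generalize ‖x‖ ^ (-β * (-α/β + 1)) = u
    rw [hden]
    field_simp
  · rw [Set.indicator_of_notMem (show x ∉ {y : E | 1 < ‖y‖} from hx)]
    refine setIntegral_eq_zero_of_forall_eq_zero fun t ht => ?_
    refine Set.indicator_of_notMem (fun h => hx ?_) _
    rw [Set.mem_ofPred_eq, hnorm t ht.1] at h
    exact h.trans_le (mul_le_of_le_one_left (norm_nonneg x)
      (Real.rpow_le_one ht.1.le ht.2 (by positivity)))

lemma levyMeasureJ_one_lt_norm_lt_top {d : ℕ} {M : Measure (EuclideanSpace ℝ (Fin d))}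
    [SFinite M] {β : ℝ} (hβ : 0 < β) (hfin : M {x | 1 < ‖x‖} < ⊤) :
    levyMeasureJ M β {x | 1 < ‖x‖} < ⊤ := by
  rw [levyMeasureJ_eq_map_prod, Measure.map_apply (by fun_prop)
    (measurableSet_lt measurable_const measurable_norm)]
  have hae : ∀ᵐ p ∂((volume.restrict (Set.Ioc (0:ℝ) 1)).prod M), p.1 ∈ Set.Ioc (0:ℝ) 1 :=
    Measure.quasiMeasurePreserving_fst.ae (ae_restrict_mem measurableSet_Ioc)
  calc _ ≤ ((volume.restrict (Set.Ioc (0:ℝ) 1)).prod M) (Set.univ ×ˢ {x | 1 < ‖x‖}) := by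
        refine measure_mono_ae ?_
        filter_upwards [hae] with p hp h
        refine ⟨trivial, ?_⟩
        replace h : 1 < ‖(p.1 ^ (1/β)) • p.2‖ := h
        rw [norm_smul, Real.norm_of_nonneg (Real.rpow_nonneg hp.1.le _)] at h
        exact h.trans_le (mul_le_of_le_one_left (norm_nonneg _)
          (Real.rpow_le_one hp.1.le hp.2 (by positivity)))
    _ < ⊤ := by
        rw [Measure.prod_prod]
        exact ENNReal.mul_lt_top (measure_lt_top _ _) hfin

lemma setIntegral_levyMeasureJ {d : ℕ} {M : Measure (EuclideanSpace ℝ (Fin d))} [SFinite M]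
    {α β : ℝ} (hα : 0 < α) (hβ : 0 < β) (hαβ : α ≠ β) (hfin : M {x | 1 < ‖x‖} < ⊤) :
    ∫ x in {x : EuclideanSpace ℝ (Fin d) | 1 < ‖x‖}, (‖x‖ ^ (-1 - α)) • x ∂(levyMeasureJ M β)
      = (β / (β - α)) •
        ((∫ x in {x : EuclideanSpace ℝ (Fin d) | 1 < ‖x‖}, (‖x‖ ^ (-1 - α)) • x ∂M)
          - ∫ x in {x : EuclideanSpace ℝ (Fin d) | 1 < ‖x‖}, (‖x‖ ^ (-1 - β)) • x ∂M) := by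
  have hS : MeasurableSet {x : EuclideanSpace ℝ (Fin d) | 1 < ‖x‖} :=
    measurableSet_lt measurable_const measurable_norm
  have hg : Measurable fun p : ℝ × EuclideanSpace ℝ (Fin d) => (p.1 ^ (1/β)) • p.2 := by
    fun_prop
  have hint := (integrable_indicator_iff hS).2
    (integrableOn_norm_rpow_smul hα.le (levyMeasureJ_one_lt_norm_lt_top hβ hfin))
  rw [← integral_indicator hS]
  rw [levyMeasureJ_eq_map_prod] at hint ⊢
  rw [integral_map hg.aemeasurable hint.aestronglyMeasurable]
  refine (integral_prod_symm _ (hint.comp_measurable hg)).trans ?_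
  simp_rw [Function.comp_apply, integral_Ioc_norm_rpow_smul hβ hαβ]
  rw [integral_indicator hS, integral_smul, integral_sub
    (integrableOn_norm_rpow_smul hα.le hfin) (integrableOn_norm_rpow_smul hβ.le hfin)]

/-- Proposition 3(i): the shift vector of `𝒥^α(𝒥^β(μ))` for `μ = [a,R,M]`,
namely `a^{(α,β)} = (α/(α+1))(a^{(β)} + b_{M^{(β)},α})`, equals
`(αβ/((1+α)(1+β))) a + (αβ/(β-α))[(1/(α+1)) b_{M,α} - (1/(β+1)) b_{M,β}]`,
which in turn equals `(β/(β-α)) a^{(α)} - (α/(β-α)) a^{(β)}`. -/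
theorem shift_vector_composition {d : ℕ} (α β : ℝ) (hα : 0 < α) (hβ : 0 < β) (hαβ : α ≠ β)
    (a : EuclideanSpace ℝ (Fin d))
    (M : Measure (EuclideanSpace ℝ (Fin d))) [SigmaFinite M]
    (h0 : M {0} = 0) (hfin : M {x | 1 < ‖x‖} < ⊤)
    (bMα bMβ bMβα aα aβ aαβ : EuclideanSpace ℝ (Fin d))
    (hbMα : bMα = ∫ x in {x : EuclideanSpace ℝ (Fin d) | 1 < ‖x‖}, (‖x‖ ^ (-1 - α)) • x ∂M)
    (hbMβ : bMβ = ∫ x in {x : EuclideanSpace ℝ (Fin d) | 1 < ‖x‖}, (‖x‖ ^ (-1 - β)) • x ∂M)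
    (hbMβα : bMβα = ∫ x in {x : EuclideanSpace ℝ (Fin d) | 1 < ‖x‖},
        (‖x‖ ^ (-1 - α)) • x ∂(levyMeasureJ M β))
    (haα : aα = (α / (α + 1)) • (a + bMα))
    (haβ : aβ = (β / (β + 1)) • (a + bMβ))
    (haαβ : aαβ = (α / (α + 1)) • (aβ + bMβα)) :
    aαβ = (α * β / ((1 + α) * (1 + β))) • a
        + (α * β / (β - α)) • ((α + 1)⁻¹ • bMα - (β + 1)⁻¹ • bMβ) ∧
    aαβ = (β / (β - α)) • aα - (α / (β - α)) • aβ := by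
  have hJ : bMβα = (β / (β - α)) • (bMα - bMβ) := by
    rw [hbMβα, hbMα, hbMβ, setIntegral_levyMeasureJ hα hβ hαβ hfin]
  have hβα : β - α ≠ 0 := sub_ne_zero.2 hαβ.symm
  have hα1 : 1 + α ≠ 0 := by positivity
  have hβ1 : 1 + β ≠ 0 := by positivity
  rw [haαβ, haα, haβ, hJ, add_comm α 1, add_comm β 1]
  constructor <;> match_scalars <;> field_simp <;> ring
end

section
/- Let λ > 0 and 0 < α < β, and let M_e be the measure on (0,∞) with density x ↦ e^{−λx}/x. Then for every Borel set A ⊆ (0,∞): M_e^{(α,β)}(A) := ∫₀¹ ∫₀¹ ∫₀^∞ 1_A(t^{1/α} s^{1/β} x) (e^{−λx}/x) dx ds dt = (αβ/(β−α)) ∫_A [ x^{α−1} ∫_x^∞ u^{−α−1} e^{−λu} du − x^{β−1} ∫_x^∞ u^{−β−1} e^{−λu} du ] dx, the integrand in square brackets being nonnegative on (0,∞); i.e., the density of M_e^{(α,β)} is a combination (with variable coefficients) of two incomplete gamma functions. (Example (c), formula (12).) -/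
open MeasureTheory

/-- The Lévy measure of the exponential distribution with parameter `l`:
the measure on `(0,∞)` with density `x ↦ e^{-l x}/x`. -/
noncomputable def expLevyMeasure (l : ℝ) : Measure ℝ :=
  (volume.restrict (Set.Ioi (0:ℝ))).withDensity
    fun x => ENNReal.ofReal (Real.exp (-(l * x)) / x)

open Set

theorem lintegral_Ioc_rpow_one_div {γ : ℝ} (hγ : 0 < γ) (G : ℝ → ENNReal) :
    ∫⁻ t in Ioc (0:ℝ) 1, G (t ^ (1 / γ)) =
      ∫⁻ a in Ioc (0:ℝ) 1, ENNReal.ofReal (γ * a ^ (γ - 1)) * G a := by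
  have himage : (fun a : ℝ => a ^ γ) '' Ioc 0 1 = Ioc 0 1 := by
    ext t
    constructor
    · rintro ⟨a, ⟨h0, h1⟩, rfl⟩
      exact ⟨Real.rpow_pos_of_pos h0 _, Real.rpow_le_one h0.le h1 hγ.le⟩
    · rintro ⟨h0, h1⟩
      refine ⟨t ^ (1 / γ), ⟨Real.rpow_pos_of_pos h0 _,
        Real.rpow_le_one h0.le h1 (by positivity)⟩, ?_⟩
      simp only
      rw [← Real.rpow_mul h0.le, one_div_mul_cancel hγ.ne', Real.rpow_one]
  have hinj : InjOn (fun a : ℝ => a ^ γ) (Ioc 0 1) := by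
    intro a ha b hb hab
    exact Real.rpow_left_injOn hγ.ne' ha.1.le hb.1.le hab
  have h := lintegral_image_eq_lintegral_abs_deriv_mul measurableSet_Ioc
    (fun a (ha : a ∈ Ioc (0:ℝ) 1) =>
      (Real.hasDerivAt_rpow_const (p := γ) (Or.inl ha.1.ne')).hasDerivWithinAt)
    hinj (fun t => G (t ^ (1 / γ)))
  rw [himage] at h
  rw [h]
  refine setLIntegral_congr_fun measurableSet_Ioc fun a ha => ?_
  have ha0 : 0 < a := ha.1
  rw [abs_of_nonneg (by positivity), ← Real.rpow_mul ha0.le, mul_one_div_cancel hγ.ne',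
    Real.rpow_one]

theorem lintegral_Ioc_rpow_mul_comp_mul {a β : ℝ} (ha : 0 < a) (G : ℝ → ENNReal) :
    ∫⁻ b in Ioc (0:ℝ) 1, ENNReal.ofReal (β * b ^ (β - 1)) * G (a * b) =
      ∫⁻ c in Ioc 0 a, ENNReal.ofReal (β * c ^ (β - 1) * a ^ (-β)) * G c := by
  have himage : (fun b : ℝ => a * b) '' Ioc 0 1 = Ioc 0 a := by
    rw [image_mul_left_Ioc ha]; simp
  have h := lintegral_image_eq_lintegral_abs_deriv_mul measurableSet_Ioc
    (fun b (_ : b ∈ Ioc (0:ℝ) 1) => ((hasDerivAt_id b).const_mul a).hasDerivWithinAt)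
    (mul_right_injective₀ ha.ne').injOn
    (fun c => ENNReal.ofReal (β * c ^ (β - 1) * a ^ (-β)) * G c)
  simp only [id] at h
  rw [himage] at h
  rw [h]
  refine setLIntegral_congr_fun measurableSet_Ioc fun b hb => ?_
  have hb0 : 0 < b := hb.1
  rw [← mul_assoc, mul_one, abs_of_pos ha, ← ENNReal.ofReal_mul ha.le,
    Real.mul_rpow ha.le hb0.le]
  congr 2
  have : a ^ (β - 1) * a ^ (-β) * a = 1 := by
    nth_rw 3 [← Real.rpow_one a]
    rw [← Real.rpow_add ha, ← Real.rpow_add ha, show β - 1 + -β + 1 = 0 by ring, Real.rpow_zero]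
  linear_combination (- β * b ^ (β - 1)) * this

theorem lintegral_Icc_mul_rpow {α β c : ℝ} (hα : 0 < α) (hαβ : α < β) (hc : 0 < c) (hc1 : c ≤ 1) :
    ∫⁻ a in Icc c 1, ENNReal.ofReal (α * a ^ (α - 1)) * ENNReal.ofReal (β * c ^ (β - 1) * a ^ (-β)) =
      ENNReal.ofReal (α * β / (β - α) * (c ^ (α - 1) - c ^ (β - 1))) := by
  have hβ : 0 < β := hα.trans hαβ
  have hne : β - α ≠ 0 := (sub_pos.2 hαβ).ne'
  have hcongr : ∫⁻ a in Icc c 1,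
        ENNReal.ofReal (α * a ^ (α - 1)) * ENNReal.ofReal (β * c ^ (β - 1) * a ^ (-β)) =
      ∫⁻ a in Icc c 1, ENNReal.ofReal (α * β * c ^ (β - 1) * a ^ (α - β - 1)) := by
    refine setLIntegral_congr_fun measurableSet_Icc fun a ha => ?_
    have ha0 : 0 < a := hc.trans_le ha.1
    rw [← ENNReal.ofReal_mul (by positivity), show α - β - 1 = (α - 1) + (-β) by ring,
      Real.rpow_add ha0]
    congr 1; ring
  have hcont : ContinuousOn (fun a : ℝ => α * β * c ^ (β - 1) * a ^ (α - β - 1)) (Icc c 1) := by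
    refine continuousOn_const.mul fun a ha => ?_
    exact (Real.continuousAt_rpow_const a _ (Or.inl (hc.trans_le ha.1).ne')).continuousWithinAt
  rw [hcongr, ← ofReal_integral_eq_lintegral_ofReal hcont.integrableOn_Icc]
  · rw [integral_Icc_eq_integral_Ioc, ← intervalIntegral.integral_of_le hc1,
      intervalIntegral.integral_const_mul, integral_rpow]
    · congr 1
      have h1 : c ^ (β - 1) * c ^ (α - β) = c ^ (α - 1) := by
        rw [← Real.rpow_add hc]; ring_nf
      have hne' : α - β ≠ 0 := (sub_neg.2 hαβ).ne
      rw [sub_add_cancel, Real.one_rpow, ← h1]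
      field_simp
      ring
    · right
      refine ⟨fun h => by linarith, fun h => ?_⟩
      rw [uIcc_of_le hc1] at h
      exact hc.not_ge h.1
  · refine (ae_restrict_iff' measurableSet_Icc).2 (ae_of_all _ fun a ha => ?_)
    have ha0 : 0 < a := hc.trans_le ha.1
    simp only [Pi.zero_apply]
    positivity

theorem lintegral_lintegral_rpow_mul_rpow {α β : ℝ} (hα : 0 < α) (hαβ : α < β)
    {G : ℝ → ENNReal} (hG : Measurable G) :
    ∫⁻ t in Ioc (0:ℝ) 1, ∫⁻ s in Ioc (0:ℝ) 1, G (t ^ (1 / α) * s ^ (1 / β)) =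
      ∫⁻ c in Ioc (0:ℝ) 1,
        ENNReal.ofReal (α * β / (β - α) * (c ^ (α - 1) - c ^ (β - 1))) * G c := by
  have hβ : 0 < β := hα.trans hαβ
  rw [lintegral_Ioc_rpow_one_div hα (fun a => ∫⁻ s in Ioc (0:ℝ) 1, G (a * s ^ (1 / β)))]
  let K : ℝ → ℝ → ENNReal := fun a c =>
    ENNReal.ofReal (α * a ^ (α - 1)) * ENNReal.ofReal (β * c ^ (β - 1) * a ^ (-β))
  have hK : Measurable fun p : ℝ × ℝ => K p.1 p.2 := by
    dsimp only [K]; fun_prop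
  let T : Set (ℝ × ℝ) := {p | p.2 ≤ p.1}
  have hT : MeasurableSet T := measurableSet_le measurable_snd measurable_fst
  let Φ : ℝ × ℝ → ENNReal := T.indicator fun p => K p.1 p.2 * G p.2
  have hΦ : Measurable Φ := (hK.mul (hG.comp measurable_snd)).indicator hT
  have hleft : ∫⁻ a in Ioc (0:ℝ) 1, ENNReal.ofReal (α * a ^ (α - 1)) *
        ∫⁻ s in Ioc (0:ℝ) 1, G (a * s ^ (1 / β)) =
      ∫⁻ a in Ioc (0:ℝ) 1, ∫⁻ c in Ioc (0:ℝ) 1, Φ (a, c) := by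
    refine setLIntegral_congr_fun measurableSet_Ioc fun a ha => ?_
    rw [lintegral_Ioc_rpow_one_div hβ (fun b => G (a * b)),
      lintegral_Ioc_rpow_mul_comp_mul ha.1, ← lintegral_const_mul' _ _ ENNReal.ofReal_ne_top]
    have h : (fun c => Φ (a, c)) = (Iic a).indicator fun c => K a c * G c := by
      ext c; simp [Φ, T, indicator]
    rw [h, setLIntegral_indicator measurableSet_Iic, inter_comm, Ioc_inter_Iic, min_eq_right ha.2]
    simp only [K, mul_assoc]
  rw [hleft, lintegral_lintegral_swap (f := fun a c => Φ (a, c)) hΦ.aemeasurable]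
  refine setLIntegral_congr_fun measurableSet_Ioc fun c hc => ?_
  have h : (fun a => Φ (a, c)) = (Ici c).indicator fun a => K a c * G c := by
    ext a; simp [Φ, T, indicator]
  have hset : Ici c ∩ Ioc 0 1 = Icc c 1 := by
    ext a
    simp only [mem_inter_iff, mem_Ici, mem_Ioc, mem_Icc]
    exact ⟨fun h => ⟨h.1, h.2.2⟩, fun h => ⟨h.1, hc.1.trans_le h.1, h.2⟩⟩
  have hKc : Measurable fun a => K a c := hK.comp measurable_prodMk_right
  rw [h, setLIntegral_indicator measurableSet_Ici, hset,
    lintegral_mul_const _ hKc,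
    ← lintegral_Icc_mul_rpow hα hαβ hc.1 hc.2]

theorem expLevyMeasure_preimage_mul (l : ℝ) {c : ℝ} (hc : 0 < c) {A : Set ℝ}
    (hA : MeasurableSet A) (hA' : A ⊆ Ioi 0) :
    expLevyMeasure l {x | c * x ∈ A} =
      ∫⁻ y in A, ENNReal.ofReal (Real.exp (-(l * (y / c))) / y) := by
  have hmeas : MeasurableSet {x | c * x ∈ A} := (measurable_const_mul c) hA
  have hinter : {x | c * x ∈ A} ∩ Ioi 0 = {x | c * x ∈ A} :=
    inter_eq_left.2 fun x hx => pos_of_mul_pos_right (hA' hx) hc.le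
  have himage : (fun y => y / c) '' A = {x | c * x ∈ A} := by
    ext x
    constructor
    · rintro ⟨y, hy, rfl⟩
      simpa [mul_div_cancel₀ _ hc.ne'] using hy
    · intro hx
      exact ⟨c * x, hx, mul_div_cancel_left₀ _ hc.ne'⟩
  have h := lintegral_image_eq_lintegral_abs_deriv_mul hA
    (fun y (_ : y ∈ A) => ((hasDerivAt_id y).div_const c).hasDerivWithinAt)
    (fun a _ b _ hab => (div_left_inj' hc.ne').1 hab)
    (fun x => ENNReal.ofReal (Real.exp (-(l * x)) / x))
  simp only [id] at h
  rw [expLevyMeasure, withDensity_apply _ hmeas, Measure.restrict_restrict hmeas, hinter, ← himage,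
    h]
  refine setLIntegral_congr_fun hA fun y hy => ?_
  have hy0 : 0 < y := hA' hy
  rw [← ENNReal.ofReal_mul (abs_nonneg _), abs_of_pos (by positivity)]
  congr 1
  field_simp

theorem integrableOn_rpow_mul_exp_neg_div {γ l x : ℝ} (hγ : 0 < γ) (hl : 0 < l) (hx : 0 < x) :
    IntegrableOn (fun c : ℝ => c ^ (γ - 1) * Real.exp (-(l * (x / c)))) (Ioo 0 1) := by
  have hint : IntegrableOn (fun c : ℝ => c ^ (γ - 1)) (Ioo 0 1) :=
    (intervalIntegral.integrableOn_Ioo_rpow_iff one_pos).2 (by linarith)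
  refine Integrable.mono' hint (by fun_prop) ?_
  refine (ae_restrict_iff' measurableSet_Ioo).2 (ae_of_all _ fun c hc => ?_)
  have hc0 : 0 < c := hc.1
  rw [Real.norm_of_nonneg (by positivity)]
  refine mul_le_of_le_one_right (by positivity) (Real.exp_le_one_iff.2 ?_)
  have : 0 < l * (x / c) := by positivity
  linarith

theorem rpow_mul_integral_Ioi_rpow_mul_exp_neg (γ l : ℝ) {x : ℝ} (hx : 0 < x) :
    x ^ (γ - 1) * (∫ u in Ioi x, u ^ (-γ - 1) * Real.exp (-(l * u))) =
      x⁻¹ * ∫ c in Ioo (0:ℝ) 1, c ^ (γ - 1) * Real.exp (-(l * (x / c))) := by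
  have himage : (fun c : ℝ => x / c) '' Ioo 0 1 = Ioi x := by
    ext u
    constructor
    · rintro ⟨c, ⟨h0, h1⟩, rfl⟩
      exact (lt_div_iff₀ h0).2 (mul_lt_of_lt_one_right hx h1)
    · intro hu
      have hu0 : 0 < u := hx.trans hu
      exact ⟨x / u, ⟨div_pos hx hu0, (div_lt_one hu0).2 hu⟩, div_div_cancel₀ hx.ne'⟩
  have hinj : InjOn (fun c : ℝ => x / c) (Ioo 0 1) := by
    intro a ha b hb hab
    have hab' : x / a = x / b := hab
    rw [div_eq_div_iff ha.1.ne' hb.1.ne'] at hab'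
    exact (mul_left_cancel₀ hx.ne' hab').symm
  have h := integral_image_eq_integral_abs_deriv_smul measurableSet_Ioo
    (fun c (hc : c ∈ Ioo (0:ℝ) 1) =>
      ((hasDerivAt_inv hc.1.ne').const_mul x).hasDerivWithinAt)
    hinj (fun u => u ^ (-γ - 1) * Real.exp (-(l * u)))
  simp only [← div_eq_mul_inv] at h
  rw [himage] at h
  rw [h, ← integral_const_mul, ← integral_const_mul]
  refine setIntegral_congr_fun measurableSet_Ioo fun c hc => ?_
  have hc0 : 0 < c := hc.1
  simp only [smul_eq_mul]
  have habs : |x * -(c ^ 2)⁻¹| = x * (c ^ 2)⁻¹ := by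
    rw [mul_neg, abs_neg, abs_of_pos (by positivity)]
  have hxpow : x ^ (γ - 1) * x ^ (-γ - 1) = (x ^ 2)⁻¹ := by
    rw [← Real.rpow_add hx, ← Real.rpow_natCast, ← Real.rpow_neg hx.le]
    congr 1; push_cast; ring
  have hcpow : c ^ (γ - 1) = (c ^ (-γ - 1))⁻¹ * (c ^ 2)⁻¹ := by
    rw [← Real.rpow_neg hc0.le, ← Real.rpow_natCast, ← Real.rpow_neg hc0.le, ← Real.rpow_add hc0]
    congr 1; push_cast; ring
  rw [habs, Real.div_rpow hx.le hc0.le, hcpow, div_eq_mul_inv (x ^ _)]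
  calc _ = (x ^ (γ - 1) * x ^ (-γ - 1)) * x *
        ((c ^ (-γ - 1))⁻¹ * (c ^ 2)⁻¹ * Real.exp (-(l * (x / c)))) := by ring
    _ = _ := by rw [hxpow]; field_simp

theorem incompleteGamma_bracket_eq {α β l x : ℝ} (hα : 0 < α) (hαβ : α < β) (hl : 0 < l)
    (hx : 0 < x) :
    x ^ (α - 1) * (∫ u in Ioi x, u ^ (-α - 1) * Real.exp (-(l * u)))
        - x ^ (β - 1) * (∫ u in Ioi x, u ^ (-β - 1) * Real.exp (-(l * u))) =
      ∫ c in Ioo (0:ℝ) 1, (c ^ (α - 1) - c ^ (β - 1)) * (Real.exp (-(l * (x / c))) / x) := by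
  rw [rpow_mul_integral_Ioi_rpow_mul_exp_neg α l hx, rpow_mul_integral_Ioi_rpow_mul_exp_neg β l hx,
    ← mul_sub, ← integral_sub (integrableOn_rpow_mul_exp_neg_div hα hl hx)
      (integrableOn_rpow_mul_exp_neg_div (hα.trans hαβ) hl hx), ← integral_const_mul]
  refine integral_congr_ae (ae_of_all _ fun c => ?_)
  simp only
  ring

theorem rpow_sub_rpow_mul_exp_nonneg {α β : ℝ} (hαβ : α < β) (l : ℝ) {x c : ℝ} (hx : 0 < x)
    (hc : c ∈ Ioo (0:ℝ) 1) :
    0 ≤ (c ^ (α - 1) - c ^ (β - 1)) * (Real.exp (-(l * (x / c))) / x) :=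
  mul_nonneg (sub_nonneg.2 (Real.rpow_le_rpow_of_exponent_ge hc.1 hc.2.le (by linarith)))
    (by positivity)

theorem lintegral_rpow_sub_rpow_mul_exp {α β l x : ℝ} (hα : 0 < α) (hαβ : α < β) (hl : 0 < l)
    (hx : 0 < x) :
    ∫⁻ c in Ioc (0:ℝ) 1, ENNReal.ofReal (α * β / (β - α) * (c ^ (α - 1) - c ^ (β - 1))) *
        ENNReal.ofReal (Real.exp (-(l * (x / c))) / x) =
      ENNReal.ofReal (α * β / (β - α)) * ENNReal.ofReal
        (x ^ (α - 1) * (∫ u in Ioi x, u ^ (-α - 1) * Real.exp (-(l * u)))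
          - x ^ (β - 1) * (∫ u in Ioi x, u ^ (-β - 1) * Real.exp (-(l * u)))) := by
  have hβ : 0 < β := hα.trans hαβ
  have hk : 0 ≤ α * β / (β - α) := div_nonneg (by positivity) (sub_pos.2 hαβ).le
  have hint : IntegrableOn
      (fun c : ℝ => (c ^ (α - 1) - c ^ (β - 1)) * (Real.exp (-(l * (x / c))) / x)) (Ioo 0 1) := by
    refine (((integrableOn_rpow_mul_exp_neg_div hα hl hx).sub
      (integrableOn_rpow_mul_exp_neg_div hβ hl hx)).const_mul x⁻¹).congr (ae_of_all _ fun c => ?_)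
    simp only [Pi.sub_apply]
    ring
  rw [incompleteGamma_bracket_eq hα hαβ hl hx, ofReal_integral_eq_lintegral_ofReal hint
    ((ae_restrict_iff' measurableSet_Ioo).2 (ae_of_all _ fun c hc =>
      rpow_sub_rpow_mul_exp_nonneg hαβ l hx hc)),
    ← lintegral_const_mul' _ _ ENNReal.ofReal_ne_top, restrict_Ioo_eq_restrict_Ioc]
  refine lintegral_congr fun c => ?_
  rw [ENNReal.ofReal_mul hk, mul_assoc, ENNReal.ofReal_mul' (by positivity)]

/-- Example (c), formula (12):
`M_e^{(α,β)}(A) = ∫₀¹∫₀¹ M_e({x : t^{1/α} s^{1/β} x ∈ A}) ds dt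
  = (αβ/(β-α)) ∫_A [x^{α-1} ∫_x^∞ u^{-α-1} e^{-λu} du
      - x^{β-1} ∫_x^∞ u^{-β-1} e^{-λu} du] dx`,
the bracketed integrand being nonnegative on `(0,∞)`: the density of
`M_e^{(α,β)}` is a combination (with variable coefficients) of two incomplete
gamma functions. -/
theorem expLevyMeasure_composition_density (l α β : ℝ) (hl : 0 < l)
    (hα : 0 < α) (hαβ : α < β)
    (A : Set ℝ) (hA : MeasurableSet A) (hA' : A ⊆ Set.Ioi 0) :
    (∀ x ∈ Set.Ioi (0:ℝ),
      0 ≤ x ^ (α - 1) * (∫ u in Set.Ioi x, u ^ (-α - 1) * Real.exp (-(l * u)))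
        - x ^ (β - 1) * (∫ u in Set.Ioi x, u ^ (-β - 1) * Real.exp (-(l * u)))) ∧
    (∫⁻ t in Set.Ioc (0:ℝ) 1, ∫⁻ s in Set.Ioc (0:ℝ) 1,
        expLevyMeasure l {x | t ^ (1/α) * s ^ (1/β) * x ∈ A}) =
      ENNReal.ofReal (α * β / (β - α)) *
        ∫⁻ x in A, ENNReal.ofReal
          (x ^ (α - 1) * (∫ u in Set.Ioi x, u ^ (-α - 1) * Real.exp (-(l * u)))
            - x ^ (β - 1) * (∫ u in Set.Ioi x, u ^ (-β - 1) * Real.exp (-(l * u)))) := by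
  refine ⟨fun x hx => ?_, ?_⟩
  · rw [incompleteGamma_bracket_eq hα hαβ hl hx]
    exact setIntegral_nonneg measurableSet_Ioo fun c hc => rpow_sub_rpow_mul_exp_nonneg hαβ l hx hc
  have hg : Measurable fun p : ℝ × ℝ =>
      ENNReal.ofReal (Real.exp (-(l * (p.2 / p.1))) / p.2) := by fun_prop
  have hleft : (∫⁻ t in Ioc (0:ℝ) 1, ∫⁻ s in Ioc (0:ℝ) 1,
        expLevyMeasure l {x | t ^ (1/α) * s ^ (1/β) * x ∈ A}) =
      ∫⁻ t in Ioc (0:ℝ) 1, ∫⁻ s in Ioc (0:ℝ) 1, (fun c => ∫⁻ y in A,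
        ENNReal.ofReal (Real.exp (-(l * (y / c))) / y)) (t ^ (1/α) * s ^ (1/β)) := by
    refine setLIntegral_congr_fun measurableSet_Ioc fun t ht =>
      setLIntegral_congr_fun measurableSet_Ioc fun s hs => ?_
    exact expLevyMeasure_preimage_mul l
      (mul_pos (Real.rpow_pos_of_pos ht.1 _) (Real.rpow_pos_of_pos hs.1 _)) hA hA'
  rw [hleft, lintegral_lintegral_rpow_mul_rpow hα hαβ hg.lintegral_prod_right']
  simp only [← lintegral_const_mul' _ _ ENNReal.ofReal_ne_top]
  rw [lintegral_lintegral_swap (by fun_prop)]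
  exact setLIntegral_congr_fun hA fun x hx => lintegral_rpow_sub_rpow_mul_exp hα hαβ hl (hA' hx)
end
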